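/- Let E be a finite set and let A, B ⊆ ℤ^{E × E} be finite sets. Then (A† * B†)† = (A*B)†. -/

import Mathlib

open Filter Set

structure DirGraph (V E : Type) where
  src : E → V
  tgt : E → V

namespace DirGraph

variable {V E : Type}

/-- A (finite) walk: consecutive edges are compatible. -/
def IsWalkList (G : DirGraph V E) (p : List E) : Prop :=
  p.Chain' fun e f => G.tgt e = G.src f

/-- The set of walks of length `n`. -/
def walks (G : DirGraph V E) (n : ℕ) : Set (List E) :=
  {p | p.length = n ∧ G.IsWalkList p}

/-- The set of walks of length `n` from `v` to `w`. -/
def walksFT (G : DirGraph V E) (n : ℕ) (v w : V) : Set (List E) :=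
  {p | p.length = n ∧ G.IsWalkList p ∧
    ∃ h : p ≠ [], G.src (p.head h) = v ∧ G.tgt (p.getLast h) = w}

def IsCycle (G : DirGraph V E) (p : List E) : Prop :=
  G.IsWalkList p ∧ ∃ h : p ≠ [], G.src (p.head h) = G.tgt (p.getLast h)

def Irreducible (G : DirGraph V E) : Prop :=
  ∀ v w : V, ∃ n : ℕ, (G.walksFT n v w).Nonempty

/-- Irreducible and the gcd of all cycle lengths is 1 (every common divisor of
the cycle lengths equals 1). -/
def Primitive (G : DirGraph V E) : Prop :=
  G.Irreducible ∧ ∀ d : ℕ, (∀ p, G.IsCycle p → d ∣ p.length) → d = 1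

end DirGraph

/-- `Σ_i P(q_i, p_i)`. -/
def payoffSum {EG EH : Type} (P : EG → EH → ℤ) (q : List EG) (p : List EH) : ℤ :=
  (List.zipWith P q p).sum

/-- `V_n(G,H,P) = max_{p ∈ W_n(H)} min_{q ∈ W_n(G)} Σ P(q_i,p_i)`. -/
noncomputable def Vn {VG EG VH EH : Type} (G : DirGraph VG EG) (H : DirGraph VH EH)
    (P : EG → EH → ℤ) (n : ℕ) : ℤ :=
  sSup ((fun p => sInf ((fun q => payoffSum P q p) '' G.walks n)) '' H.walks n)

/-- `M(p)(v,w) = inf {Σ P(q_i,p_i) : q ∈ W_n(G, v → w)}`, with `inf ∅ = ⊤`. -/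
noncomputable def Mfun {VG EG EH : Type} (G : DirGraph VG EG) (P : EG → EH → ℤ)
    (p : List EH) : VG → VG → WithTop ℤ :=
  fun v w => sInf ((fun q => ((payoffSum P q p : ℤ) : WithTop ℤ)) '' G.walksFT p.length v w)

/-- `f < g` pointwise everywhere. -/
def StrictDom {V α : Type} [LT α] (f g : V → V → α) : Prop := ∀ v w, f v w < g v w

/-- `<`-maximal elements of a set w.r.t. a strict domination relation. -/
def maxElems {α : Type} (lt : α → α → Prop) (A : Set α) : Set α :=
  {f ∈ A | ¬ ∃ g ∈ A, lt f g}

/-- Tropical convolution on `(ℤ ∪ {∞})`-valued matrices. -/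
noncomputable def tconv {V : Type} (f g : V → V → WithTop ℤ) : V → V → WithTop ℤ :=
  fun u w => sInf (Set.range fun v => f u v + g v w)

/-- Tropical convolution on `ℤ`-valued matrices. -/
noncomputable def tconvZ {V : Type} (f g : V → V → ℤ) : V → V → ℤ :=
  fun u w => sInf (Set.range fun v => f u v + g v w)

/-- Non-improvable walks in `H` (of any length). -/
noncomputable def walksDagger {VG EG VH EH : Type} (G : DirGraph VG EG) (H : DirGraph VH EH)
    (P : EG → EH → ℤ) : Set (List EH) :=
  {p | ∃ u v : VH, p ∈ H.walksFT p.length u v ∧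
    Mfun G P p ∈ maxElems StrictDom (Mfun G P '' H.walksFT p.length u v)}

/-- The edge shift of a graph. -/
def XEdge {V E : Type} (G : DirGraph V E) : Set (ℤ → E) :=
  {x | ∀ n : ℤ, G.tgt (x n) = G.src (x (n + 1))}

/-- The word `x_{[m,n]}` as a list (of length `n - m + 1` when `m ≤ n`). -/
def seg {A : Type} (x : ℤ → A) (m n : ℤ) : List A :=
  List.ofFn fun i : Fin (n + 1 - m).toNat => x (m + i)

/-- `X_H^†`: points all of whose subwords are non-improvable walks. -/
noncomputable def XHdag {VG EG VH EH : Type} (G : DirGraph VG EG) (H : DirGraph VH EH)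
    (P : EG → EH → ℤ) : Set (ℤ → EH) :=
  {x | x ∈ XEdge H ∧ ∀ m n : ℤ, m ≤ n → seg x m n ∈ walksDagger G H P}

/-- `R(p)`: optimal responses to `p`. -/
noncomputable def Rset {VG EG EH : Type} (G : DirGraph VG EG) (P : EG → EH → ℤ)
    (p : List EH) : Set (List EG) :=
  {q | ∃ v w : VG, q ∈ G.walksFT p.length v w ∧
    ((payoffSum P q p : ℤ) : WithTop ℤ) = Mfun G P p v w}

theorem StrictDom.le {V α : Type} [Preorder α] {f g : V → V → α} (h : StrictDom f g) : f ≤ g :=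
  fun v w => (h v w).le

theorem StrictDom.trans_le {V α : Type} [Preorder α] {f g h : V → V → α}
    (hfg : StrictDom f g) (hgh : g ≤ h) : StrictDom f h :=
  fun v w => (hfg v w).trans_le (hgh v w)

theorem tconvZ_le {V : Type} [Finite V] (f g : V → V → ℤ) (u v w : V) :
    tconvZ f g u w ≤ f u v + g v w :=
  csInf_le (Set.finite_range _).bddBelow (Set.mem_range_self v)

theorem exists_tconvZ_eq {V : Type} [Finite V] [Nonempty V] (f g : V → V → ℤ) (u w : V) :
    ∃ v, f u v + g v w = tconvZ f g u w :=
  (Set.range_nonempty fun v => f u v + g v w).csInf_mem (Set.finite_range _)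

theorem tconvZ_mono {V : Type} [Finite V] [Nonempty V] {f f' g g' : V → V → ℤ}
    (hf : f ≤ f') (hg : g ≤ g') : tconvZ f g ≤ tconvZ f' g' := by
  intro u w
  obtain ⟨v, hv⟩ := exists_tconvZ_eq f' g' u w
  rw [← hv]
  exact (tconvZ_le f g u v w).trans (add_le_add (hf u v) (hg v w))

theorem strictDom_tconvZ_left {V : Type} [Finite V] [Nonempty V] {f f' : V → V → ℤ}
    (hf : StrictDom f f') (g : V → V → ℤ) : StrictDom (tconvZ f g) (tconvZ f' g) := by
  intro u w
  obtain ⟨v, hv⟩ := exists_tconvZ_eq f' g u w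
  rw [← hv]
  exact (tconvZ_le f g u v w).trans_lt (add_lt_add_left (hf u v) _)

theorem strictDom_tconvZ_right {V : Type} [Finite V] [Nonempty V] {g g' : V → V → ℤ}
    (f : V → V → ℤ) (hg : StrictDom g g') : StrictDom (tconvZ f g) (tconvZ f g') := by
  intro u w
  obtain ⟨v, hv⟩ := exists_tconvZ_eq f g' u w
  rw [← hv]
  exact (tconvZ_le f g u v w).trans_lt (add_lt_add_right (hg v w) _)

theorem exists_le_mem_maxElems {V α : Type} [Nonempty V] [PartialOrder α]
    {A : Set (V → V → α)} (hA : A.Finite) {f : V → V → α} (hf : f ∈ A) :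
    ∃ g ∈ maxElems StrictDom A, f ≤ g := by
  obtain ⟨g, hfg, hg⟩ := hA.exists_le_maximal hf
  refine ⟨g, ⟨hg.prop, ?_⟩, hfg⟩
  rintro ⟨h, hh, hlt⟩
  obtain ⟨v⟩ := ‹Nonempty V›
  exact (hlt v v).not_ge (hg.le_of_ge hh hlt.le v v)

theorem maxElems_strictDom_of_isEmpty {V α : Type} [IsEmpty V] [LT α] (A : Set (V → V → α)) :
    maxElems StrictDom A = ∅ :=
  Set.eq_empty_of_forall_notMem fun f hf => hf.2 ⟨f, hf.1, fun v => isEmptyElim v⟩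

/-- `(A† * B†)† = (A * B)†` for finite sets of `ℤ`-valued matrices. -/
theorem star_trop_conv {E : Type} [Fintype E]
    (A B : Set (E → E → ℤ)) (hA : A.Finite) (hB : B.Finite) :
    maxElems StrictDom
        (Set.image2 tconvZ (maxElems StrictDom A) (maxElems StrictDom B))
      = maxElems StrictDom (Set.image2 tconvZ A B) := by
  rcases isEmpty_or_nonempty E with hE | hE
  · rw [maxElems_strictDom_of_isEmpty, maxElems_strictDom_of_isEmpty]
  apply Set.Subset.antisymm
  · rintro _ ⟨⟨f, hf, g, hg, rfl⟩, hmax⟩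
    refine ⟨⟨f, hf.1, g, hg.1, rfl⟩, ?_⟩
    rintro ⟨_, ⟨f', hf', g', hg', rfl⟩, hlt⟩
    obtain ⟨f'', hf'', hff⟩ := exists_le_mem_maxElems hA hf'
    obtain ⟨g'', hg'', hgg⟩ := exists_le_mem_maxElems hB hg'
    exact hmax ⟨_, ⟨f'', hf'', g'', hg'', rfl⟩, hlt.trans_le (tconvZ_mono hff hgg)⟩
  · rintro _ ⟨⟨f, hf, g, hg, rfl⟩, hmax⟩
    refine ⟨⟨f, ⟨hf, ?_⟩, g, ⟨hg, ?_⟩, rfl⟩, ?_⟩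
    · rintro ⟨f', hf', hlt⟩
      exact hmax ⟨_, ⟨f', hf', g, hg, rfl⟩, strictDom_tconvZ_left hlt g⟩
    · rintro ⟨g', hg', hlt⟩
      exact hmax ⟨_, ⟨f, hf, g', hg', rfl⟩, strictDom_tconvZ_right f hlt⟩
    · rintro ⟨_, ⟨f', hf', g', hg', rfl⟩, hlt⟩
      exact hmax ⟨_, ⟨f', hf'.1, g', hg'.1, rfl⟩, hlt⟩
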